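/- arXiv:2506.13548 — 4 statements merged into one kernel-verified Lean document; each statement's English description precedes it below -/
import Mathlib

section
/- Let α_1, …, α_d ∈ k (with d ≥ 1) and f(T) = ∏_{j=1}^d (T − α_j) ∈ k[T]. Let x and y be nonarchimedean multiplicative ring seminorms on k[T] extending |·|, set ρ(x) := min_{1 ≤ j ≤ d} x(T − α_j) and ρ(y) := min_{1 ≤ j ≤ d} y(T − α_j), and suppose that the same index 1 achieves both minima, i.e. x(T − α_1) = ρ(x) and y(T − α_1) = ρ(y). If ρ(x) = ρ(y), then x(f) = y(f). (The value |f| at a point of the Berkovich line depends only on the minimal distance to the roots, once a common closest root is fixed.) -/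
open Polynomial

/-- A nonarchimedean multiplicative absolute value on a field `k`. -/
structure IsNonarchAbsValue {k : Type*} [Field k] (v : k → ℝ) : Prop where
  nonneg : ∀ a, 0 ≤ v a
  map_mul : ∀ a b, v (a * b) = v a * v b
  add_le : ∀ a b, v (a + b) ≤ max (v a) (v b)
  map_one : v 1 = 1
  eq_zero_iff : ∀ a, v a = 0 ↔ a = 0

/-- A nonarchimedean multiplicative ring seminorm on `k[T]` extending the
absolute value `v`; these are exactly the points of the Berkovich closed
affine line over `k`. -/
structure IsBerkovichPoint {k : Type*} [Field k] (v : k → ℝ) (x : Polynomial k → ℝ) : Prop where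
  nonneg : ∀ g, 0 ≤ x g
  map_mul : ∀ g h, x (g * h) = x g * x h
  add_le : ∀ g h, x (g + h) ≤ max (x g) (x h)
  map_one : x 1 = 1
  map_const : ∀ c : k, x (C c) = v c

theorem berk_aux {k : Type*} [Field k] (v : k → ℝ) (x : Polynomial k → ℝ)
    (hx : IsBerkovichPoint v x) (a b : k) (h : x (X - C a) ≤ x (X - C b)) :
    x (X - C b) = max (x (X - C a)) (v (a - b)) := by
  have h1 : x (-1) = 1 := by
    have h2 : x (-1) * x (-1) = 1 := by
      rw [← hx.map_mul, neg_mul_neg, one_mul, hx.map_one]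
    nlinarith [hx.nonneg (-1)]
  have hneg : x (-(X - C a)) = x (X - C a) := by
    rw [← neg_one_mul, hx.map_mul, h1, one_mul]
  apply le_antisymm
  · have e : (X - C b : Polynomial k) = (X - C a) + C (a - b) := by
      rw [C_sub]; ring
    rw [← hx.map_const, e]
    exact hx.add_le _ _
  · apply max_le h
    have e : (C (a - b) : Polynomial k) = (X - C b) + -(X - C a) := by
      rw [C_sub]; ring
    rw [← hx.map_const, e]
    refine (hx.add_le _ _).trans (max_le le_rfl ?_)
    rw [hneg]; exact h

theorem berk_prod {k : Type*} [Field k] (v : k → ℝ) (x : Polynomial k → ℝ)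
    (hx : IsBerkovichPoint v x) {ι : Type*} (s : Finset ι) (g : ι → Polynomial k) :
    x (∏ j ∈ s, g j) = ∏ j ∈ s, x (g j) := by
  classical
  induction s using Finset.induction_on with
  | empty => simpa using hx.map_one
  | insert a s ha ih => rw [Finset.prod_insert ha, Finset.prod_insert ha, hx.map_mul, ih]

/-- The value `x(f)` of `f = ∏ (T - α j)` at a point of the Berkovich line
depends only on the minimal distance to the roots, once a common closest root
`α i` is fixed: if `ρ(x) = ρ(y)` then `x(f) = y(f)`. -/
theorem value_depends_only_on_rho {k : Type*} [Field k] (v : k → ℝ)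
    (hv : IsNonarchAbsValue v)
    (d : ℕ) (α : Fin (d + 1) → k)
    (x y : Polynomial k → ℝ) (hx : IsBerkovichPoint v x) (hy : IsBerkovichPoint v y)
    (i : Fin (d + 1))
    (hix : ∀ j, x (X - C (α i)) ≤ x (X - C (α j)))
    (hiy : ∀ j, y (X - C (α i)) ≤ y (X - C (α j)))
    (hρ : x (X - C (α i)) = y (X - C (α i))) :
    x (∏ j : Fin (d + 1), (X - C (α j))) = y (∏ j : Fin (d + 1), (X - C (α j))) := by
  rw [berk_prod v x hx, berk_prod v y hy]
  refine Finset.prod_congr rfl fun j _ => ?_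
  rw [berk_aux v x hx _ _ (hix j), berk_aux v y hy _ _ (hiy j), hρ]
end

section
/- Let α_1, …, α_d ∈ k (with d ≥ 1) and f(T) = ∏_{j=1}^d (T − α_j) ∈ k[T]. Let x and y be nonarchimedean multiplicative ring seminorms on k[T] extending |·|, set ρ(x) := min_{1 ≤ j ≤ d} x(T − α_j) and ρ(y) := min_{1 ≤ j ≤ d} y(T − α_j), and suppose that the same index 1 achieves both minima, i.e. x(T − α_1) = ρ(x) and y(T − α_1) = ρ(y). If 0 < ρ(x) < ρ(y), then x(f) < y(f). (Strict monotonicity of |f| as a function of the minimal distance to the roots, for a common closest root.) -/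
open Polynomial

/-- Strict monotonicity of `x(f)` in the minimal distance to the roots, for a
common closest root: if `0 < ρ(x) < ρ(y)` then `x(f) < y(f)`. -/
theorem value_strict_mono {k : Type*} [Field k] (v : k → ℝ)
    (hv : IsNonarchAbsValue v)
    (d : ℕ) (α : Fin (d + 1) → k)
    (x y : Polynomial k → ℝ) (hx : IsBerkovichPoint v x) (hy : IsBerkovichPoint v y)
    (i : Fin (d + 1))
    (hix : ∀ j, x (X - C (α i)) ≤ x (X - C (α j)))
    (hiy : ∀ j, y (X - C (α i)) ≤ y (X - C (α j)))
    (hρx : 0 < x (X - C (α i)))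
    (hρ : x (X - C (α i)) < y (X - C (α i))) :
    x (∏ j : Fin (d + 1), (X - C (α j))) < y (∏ j : Fin (d + 1), (X - C (α j))) := by
  have hneg : ∀ g, y (-g) = y g := by
    intro g
    have h1 : y (-1) * y (-1) = 1 := by
      rw [← hy.map_mul]
      simpa using hy.map_one
    have h2 : y (-1) = 1 := by
      nlinarith [hy.nonneg (-1)]
    rw [← neg_one_mul, hy.map_mul, h2, one_mul]
  have hle : ∀ j, x (X - C (α j)) ≤ y (X - C (α j)) := by
    intro j
    have e1 : (X - C (α j) : Polynomial k) = (X - C (α i)) + C (α i - α j) := by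
      rw [C_sub]; ring
    have e2 : (C (α i - α j) : Polynomial k) = (X - C (α j)) + -(X - C (α i)) := by
      rw [C_sub]; ring
    have h1 := hx.add_le (X - C (α i)) (C (α i - α j))
    rw [← e1, hx.map_const] at h1
    have h2 := hy.add_le (X - C (α j)) (-(X - C (α i)))
    rw [← e2, hy.map_const, hneg, max_eq_left (hiy j)] at h2
    exact h1.trans (max_le (hρ.le.trans (hiy j)) h2)
  have hprod : ∀ z : Polynomial k → ℝ, IsBerkovichPoint v z →
      z (∏ j : Fin (d + 1), (X - C (α j))) = ∏ j : Fin (d + 1), z (X - C (α j)) := by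
    intro z hz
    let φ : Polynomial k →* ℝ := ⟨⟨z, hz.map_one⟩, hz.map_mul⟩
    exact map_prod φ _ _
  rw [hprod x hx, hprod y hy]
  exact Finset.prod_lt_prod (fun j _ => hρx.trans_le (hix j)) (fun j _ => hle j)
    ⟨i, Finset.mem_univ i, hρ⟩
end

section
/- Let α_1, …, α_d ∈ k (with d ≥ 1) and f(T) = ∏_{j=1}^d (T − α_j) ∈ k[T]. Suppose G is a group of field automorphisms σ of k such that (i) |σ(a)| = |a| for all a ∈ k, (ii) each σ ∈ G permutes the list (α_1, …, α_d) (so that the induced coefficientwise action fixes f), and (iii) G acts transitively on the roots: for all i, j there exists σ ∈ G with σ(α_i) = α_j. Let x and y be nonarchimedean multiplicative ring seminorms on k[T] extending |·| with ρ(x) := min_{1 ≤ j ≤ d} x(T − α_j) > 0 and ρ(y) := min_{1 ≤ j ≤ d} y(T − α_j) > 0. Then ρ(x) ≤ ρ(y) if and only if x(f) ≤ y(f). In particular, x(f) = y(f) if and only if ρ(x) = ρ(y), so the sublevel set {x : x(f) ≤ r} coincides with a 'closed disc' {x : min_j x(T − α_j) ≤ ρ} for a uniquely determined correspondence between r and ρ.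 -/
open Polynomial

/-- The minimal distance of a point of the Berkovich line to the roots of
`f = ∏ (T - α j)`. -/
noncomputable def rhoMin {k : Type*} [Field k] (d : ℕ) (α : Fin (d + 1) → k)
    (x : Polynomial k → ℝ) : ℝ :=
  Finset.univ.inf' Finset.univ_nonempty (fun j => x (X - C (α j)))

lemma value_eq_aux {k : Type*} [Field k] (v : k → ℝ)
    (hv : IsNonarchAbsValue v)
    (d : ℕ) (α : Fin (d + 1) → k)
    (G : Subgroup (RingAut k))
    (hG1 : ∀ σ ∈ G, ∀ a : k, v (σ a) = v a)
    (hG2 : ∀ σ ∈ G, ∃ π : Equiv.Perm (Fin (d + 1)), ∀ j, σ (α j) = α (π j))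
    (hG3 : ∀ i j : Fin (d + 1), ∃ σ ∈ G, σ (α i) = α j)
    (x : Polynomial k → ℝ) (hx : IsBerkovichPoint v x) :
    x (∏ j : Fin (d + 1), (X - C (α j))) =
      ∏ j : Fin (d + 1), max (rhoMin d α x) (v (α 0 - α j)) := by
  have hneg1 : v (-1) = 1 := by
    have h := hv.map_mul (-1) (-1)
    rw [neg_mul_neg, one_mul, hv.map_one] at h
    have h0 := hv.nonneg (-1)
    nlinarith
  obtain ⟨i, -, hi⟩ := Finset.exists_mem_eq_inf' (Finset.univ_nonempty (α := Fin (d + 1)))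
    (fun j => x (X - C (α j)))
  have hi' : rhoMin d α x = x (X - C (α i)) := hi
  have hle : ∀ j, rhoMin d α x ≤ x (X - C (α j)) := fun j =>
    Finset.inf'_le (fun j => x (X - C (α j))) (Finset.mem_univ j)
  have key : ∀ j, x (X - C (α j)) = max (rhoMin d α x) (v (α i - α j)) := by
    intro j
    apply le_antisymm
    · have h := hx.add_le (X - C (α i)) (C (α i - α j))
      rw [hx.map_const, ← hi'] at h
      have e : (X - C (α i)) + C (α i - α j) = X - C (α j) := by
        rw [C_sub]; ring
      rwa [e] at h
    · apply max_le (hle j)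
      have h := hx.add_le (X - C (α j)) (C (-1) * (X - C (α i)))
      have e : (X - C (α j)) + C (-1) * (X - C (α i)) = C (α i - α j) := by
        rw [C_sub, C_neg, C_1]; ring
      rw [e, hx.map_const, hx.map_mul, hx.map_const, hneg1, one_mul, ← hi',
        max_eq_left (hle j)] at h
      exact h
  have hprod : ∀ s : Finset (Fin (d + 1)), x (∏ j ∈ s, (X - C (α j))) =
      ∏ j ∈ s, x (X - C (α j)) := by
    intro s
    induction s using Finset.induction_on with
    | empty => simpa using hx.map_one
    | insert a s ha ih => rw [Finset.prod_insert ha, Finset.prod_insert ha, hx.map_mul, ih]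
  obtain ⟨σ, hσ, hσi⟩ := hG3 i 0
  obtain ⟨π, hπ⟩ := hG2 σ hσ
  rw [hprod, ← Equiv.prod_comp π]
  rw [← Equiv.prod_comp π (fun j => max (rhoMin d α x) (v (α 0 - α j)))]
  rw [Equiv.prod_comp π (fun j => x (X - C (α j)))]
  refine Finset.prod_congr rfl fun j _ => ?_
  rw [key, ← hG1 σ hσ, map_sub, hσi, hπ]

/-- If a group `G` of absolute-value-preserving field automorphisms of `k`
permutes the roots `α j` transitively, then for two points `x`, `y` of the
Berkovich line with positive minimal distances `ρ(x)`, `ρ(y)` to the roots one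
has `ρ(x) ≤ ρ(y)` iff `x(f) ≤ y(f)`; in particular `x(f) = y(f)` iff
`ρ(x) = ρ(y)`. -/
theorem rho_le_iff_value_le {k : Type*} [Field k] (v : k → ℝ)
    (hv : IsNonarchAbsValue v)
    (d : ℕ) (α : Fin (d + 1) → k)
    (G : Subgroup (RingAut k))
    (hG1 : ∀ σ ∈ G, ∀ a : k, v (σ a) = v a)
    (hG2 : ∀ σ ∈ G, ∃ π : Equiv.Perm (Fin (d + 1)), ∀ j, σ (α j) = α (π j))
    (hG3 : ∀ i j : Fin (d + 1), ∃ σ ∈ G, σ (α i) = α j)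
    (x y : Polynomial k → ℝ) (hx : IsBerkovichPoint v x) (hy : IsBerkovichPoint v y)
    (hρx : 0 < rhoMin d α x) (hρy : 0 < rhoMin d α y) :
    (rhoMin d α x ≤ rhoMin d α y ↔
        x (∏ j : Fin (d + 1), (X - C (α j))) ≤ y (∏ j : Fin (d + 1), (X - C (α j)))) ∧
    (x (∏ j : Fin (d + 1), (X - C (α j))) = y (∏ j : Fin (d + 1), (X - C (α j))) ↔
        rhoMin d α x = rhoMin d α y) := by
  have ex := value_eq_aux v hv d α G hG1 hG2 hG3 x hx
  have ey := value_eq_aux v hv d α G hG1 hG2 hG3 y hy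
  have v0 : v (α 0 - α 0) = 0 := by rw [sub_self]; exact (hv.eq_zero_iff 0).2 rfl
  have mono : StrictMonoOn (fun r : ℝ => ∏ j : Fin (d + 1), max r (v (α 0 - α j)))
      (Set.Ioi 0) := by
    intro r hr s hs hrs
    have hr : 0 < r := hr
    have hs : 0 < s := hs
    refine Finset.prod_lt_prod (fun j _ => lt_max_of_lt_left hr)
      (fun j _ => max_le_max hrs.le le_rfl) ⟨0, Finset.mem_univ _, ?_⟩
    rw [v0, max_eq_left hr.le, max_eq_left hs.le]
    exact hrs
  rw [ex, ey]
  exact ⟨(mono.le_iff_le hρx hρy).symm, mono.injOn.eq_iff hρx hρy⟩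
end

section
/- Let K be a field of characteristic p > 0 equipped with a nonarchimedean multiplicative absolute value making it a normed field (with the induced metric and uniform structure), and assume K is perfect (the Frobenius endomorphism a ↦ a^p is bijective). Then the uniform completion of K is again a perfect field of characteristic p, i.e. Frobenius is bijective on the completion. (In particular, for any nonarchimedean field k of characteristic p, the completion of the perfect closure k^{p^{-∞}} is a perfect nonarchimedean field.) -/
/-- Let `K` be a perfect normed field of characteristic `p > 0` whose norm is
nonarchimedean.  Then the uniform completion of `K` is again of characteristic
`p` and perfect, i.e. the Frobenius map `a ↦ a ^ p` is bijective on the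
completion. -/
theorem completion_perfect (K : Type*) [NormedField K] (p : ℕ) (hp : p.Prime)
    [CharP K p]
    (hna : ∀ a b : K, ‖a + b‖ ≤ max ‖a‖ ‖b‖)
    (hperf : Function.Bijective (fun a : K => a ^ p)) :
    CharP (UniformSpace.Completion K) p ∧
      Function.Bijective (fun a : UniformSpace.Completion K => a ^ p) := by
  haveI : Fact p.Prime := ⟨hp⟩
  have hchar : CharP (UniformSpace.Completion K) p :=
    charP_of_injective_ringHom
      (f := (UniformSpace.Completion.coeRingHom : K →+* UniformSpace.Completion K))
      (RingHom.injective _) p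
  refine ⟨hchar, fun a b h => frobenius_inj (UniformSpace.Completion K) p h, ?_⟩
  choose g hg using hperf.2
  have hg' : ∀ a, g a ^ p = a := hg
  have hd : ∀ a b, ‖g a - g b‖ ^ p = ‖a - b‖ := by
    intro a b
    rw [← norm_pow, sub_pow_char, hg', hg']
  have huc : UniformContinuous g := by
    rw [Metric.uniformContinuous_iff]
    intro ε hε
    refine ⟨ε ^ p, pow_pos hε p, fun {a b} hab => ?_⟩
    rw [dist_eq_norm] at hab ⊢
    rw [← hd] at hab
    exact lt_of_pow_lt_pow_left₀ p hε.le hab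
  intro x
  refine ⟨UniformSpace.Completion.map g x, ?_⟩
  change (UniformSpace.Completion.map g x) ^ p = x
  induction x using UniformSpace.Completion.induction_on with
  | hp => exact isClosed_eq (UniformSpace.Completion.continuous_map.pow p) continuous_id
  | ih a =>
    rw [UniformSpace.Completion.map_coe huc]
    have := map_pow (UniformSpace.Completion.coeRingHom : K →+* UniformSpace.Completion K) (g a) p
    rw [hg'] at this
    exact this.symm
end
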